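/- Let (g, [·,...,·], α, β) be an n-BiHom-Lie algebra with H²(g, g) = 0. Then g is analytically rigid: every one-parameter formal deformation f_t of g is equivalent to the null deformation f₀ = [·,...,·]. -/

import Mathlib

open Function Finset Module

universe u v w

/-- Twist a tuple: apply `a` to the last coordinate and `b` to all the other coordinates,
so that `twMap a b x = (b x₁, …, b xₙ₋₁, a xₙ)`. -/
def twMap {g : Type v} (a b : g → g) {m : ℕ} (x : Fin (m + 1) → g) : Fin (m + 1) → g :=
  fun i => if i = Fin.last m then a (x i) else b (x i)

/-- An `n`-BiHom-Lie algebra over `K`, where the arity of the bracket is `n = m + 1`. -/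
structure NBiHomLie (K : Type u) [Field K] (m : ℕ) (g : Type v)
    [AddCommGroup g] [Module K g] where
  br : MultilinearMap K (fun _ : Fin (m + 1) => g) g
  α : g →ₗ[K] g
  β : g →ₗ[K] g
  comm : ∀ z, α (β z) = β (α z)
  alpha_br : ∀ x : Fin (m + 1) → g, α (br x) = br fun i => α (x i)
  beta_br : ∀ x : Fin (m + 1) → g, β (br x) = br fun i => β (x i)
  skew : ∀ (x : Fin (m + 1) → g) (i j : Fin (m + 1)), (i : ℕ) + 1 = (j : ℕ) →
    br (twMap ⇑α ⇑β x) = - br (twMap ⇑α ⇑β (x ∘ Equiv.swap i j))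
  jacobi : ∀ (x : Fin m → g) (y : Fin (m + 1) → g),
    br (Fin.snoc (fun i => β (β (x i))) (br (twMap ⇑α ⇑β y))) =
      ∑ k : Fin (m + 1), ((-1 : K) ^ (m - (k : ℕ))) •
        br (Fin.snoc (fun i => β (β (y (k.succAbove i))))
          (br (twMap ⇑α ⇑β (Fin.snoc x (y k)))))

/-- A representation of an `n`-BiHom-Lie algebra (`n = m + 2`) on a vector space `V`. -/
structure NRep {K : Type u} [Field K] {m : ℕ} {g : Type v} [AddCommGroup g] [Module K g]
    (L : NBiHomLie K (m + 1) g) (V : Type w) [AddCommGroup V] [Module K V] where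
  ρ : MultilinearMap K (fun _ : Fin (m + 1) => g) (Module.End K V)
  αV : V →ₗ[K] V
  βV : V →ₗ[K] V
  rep1 : ∀ x : Fin (m + 1) → g, ρ (fun i => L.α (x i)) ∘ₗ αV = αV ∘ₗ ρ x
  rep2 : ∀ x : Fin (m + 1) → g, ρ (fun i => L.β (x i)) ∘ₗ βV = βV ∘ₗ ρ x
  rep3 : ∀ x y : Fin (m + 1) → g,
    ρ (fun i => L.α (L.β (x i))) ∘ₗ ρ y - ρ (fun i => L.β (y i)) ∘ₗ ρ (fun i => L.α (x i)) =
      ∑ i : Fin (m + 1),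
        ρ (Function.update (fun j => L.β (y j)) i
            (L.br (Fin.snoc (fun j => L.β (x j)) (y i)))) ∘ₗ βV
  rep4 : ∀ x y : Fin (m + 1) → g,
    ρ (Fin.snoc (fun j : Fin m => L.β (y j.succ))
        (L.br (Fin.snoc (fun j => L.β (x j)) (y 0)))) ∘ₗ βV =
      (∑ i : Fin (m + 1), ((-1 : K) ^ (m + 1 - (i : ℕ))) •
        (ρ (Fin.snoc (fun j : Fin m => L.α (L.β (x (i.succAbove j)))) (L.β (y 0))) ∘ₗ
          ρ (Fin.snoc (fun j : Fin m => y j.succ) (L.α (x i))))) +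
        ρ (fun i => L.α (L.β (x i))) ∘ₗ ρ y
/-- An `n`-Lie algebra (Filippov algebra) over `K`, where the arity is `n = m + 1`. -/
structure NLie (K : Type u) [Field K] (m : ℕ) (g : Type v)
    [AddCommGroup g] [Module K g] where
  br : MultilinearMap K (fun _ : Fin (m + 1) => g) g
  skew : ∀ (x : Fin (m + 1) → g) (i j : Fin (m + 1)), i ≠ j →
    br (x ∘ Equiv.swap i j) = - br x
  filippov : ∀ (x : Fin m → g) (y : Fin (m + 1) → g),
    br (Fin.snoc x (br y)) =
      ∑ i : Fin (m + 1), br (Function.update y i (br (Fin.snoc x (y i))))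

/-- A representation of an `n`-Lie algebra (`n = m + 2`) on a vector space `V`. -/
structure NLieRep {K : Type u} [Field K] {m : ℕ} {g : Type v} [AddCommGroup g] [Module K g]
    (L : NLie K (m + 1) g) (V : Type w) [AddCommGroup V] [Module K V] where
  ρ : MultilinearMap K (fun _ : Fin (m + 1) => g) (Module.End K V)
  repa : ∀ x y : Fin (m + 1) → g,
    ρ x ∘ₗ ρ y - ρ y ∘ₗ ρ x =
      ∑ i : Fin (m + 1), ρ (Function.update y i (L.br (Fin.snoc x (y i))))
  repb : ∀ x y : Fin (m + 1) → g,
    ρ (Fin.snoc (fun j : Fin m => y j.succ) (L.br (Fin.snoc x (y 0)))) =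
      (∑ i : Fin (m + 1), ((-1 : K) ^ (m + 1 - (i : ℕ))) •
        (ρ (Fin.snoc (fun j : Fin m => x (i.succAbove j)) (y 0)) ∘ₗ
          ρ (Fin.snoc (fun j : Fin m => y j.succ) (x i)))) + ρ x ∘ₗ ρ y

/-- An `n`-cocycle (`n = m + 2`) on an `n`-BiHom-Lie algebra `L` with values in a
representation `R`. -/
def IsNCocycle {K : Type u} [Field K] {m : ℕ} {g : Type v} {V : Type w}
    [AddCommGroup g] [Module K g] [AddCommGroup V] [Module K V]
    (L : NBiHomLie K (m + 1) g) (R : NRep L V)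
    (θ : (Fin (m + 2) → g) → V) : Prop :=
  (∀ x, R.αV (θ x) = θ fun i => L.α (x i)) ∧
  (∀ x, R.βV (θ x) = θ fun i => L.β (x i)) ∧
  (∀ (x : Fin (m + 2) → g) (i j : Fin (m + 2)), (i : ℕ) + 1 = (j : ℕ) →
    θ (fun k => L.β (x k)) = - θ (fun k => L.β (x (Equiv.swap i j k)))) ∧
  (∀ (x : Fin (m + 1) → g) (y : Fin (m + 2) → g),
    θ (Fin.snoc (fun i => L.β (L.β (x i))) (L.br (twMap ⇑L.α ⇑L.β y))) +
        R.ρ (fun i => L.β (L.β (x i))) (θ (twMap ⇑L.α ⇑L.β y)) =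
      ∑ k : Fin (m + 2), ((-1 : K) ^ (m + 1 - (k : ℕ))) •
        (θ (Fin.snoc (fun i : Fin (m + 1) => L.β (L.β (y (k.succAbove i))))
              (L.br (twMap ⇑L.α ⇑L.β (Fin.snoc x (y k))))) +
          R.ρ (fun i => L.β (L.β (y (k.succAbove i))))
            (θ (twMap ⇑L.α ⇑L.β (Fin.snoc x (y k))))))

/-- An `n`-cocycle (`n = m + 2`) with values in the coadjoint representation
`ad*(x₁,…,xₙ₋₁)(f) = - f ∘ ad(x₁,…,xₙ₋₁)` on the dual space `g*`. -/
def IsCoadCocycle {K : Type u} [Field K] {m : ℕ} {g : Type v}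
    [AddCommGroup g] [Module K g] (L : NBiHomLie K (m + 1) g)
    (θ : (Fin (m + 2) → g) → Module.Dual K g) : Prop :=
  (∀ (x : Fin (m + 2) → g) (z : g), θ x (L.α z) = θ (fun i => L.α (x i)) z) ∧
  (∀ (x : Fin (m + 2) → g) (z : g), θ x (L.β z) = θ (fun i => L.β (x i)) z) ∧
  (∀ (x : Fin (m + 2) → g) (i j : Fin (m + 2)), (i : ℕ) + 1 = (j : ℕ) →
    θ (fun k => L.β (x k)) = - θ (fun k => L.β (x (Equiv.swap i j k)))) ∧
  (∀ (x : Fin (m + 1) → g) (y : Fin (m + 2) → g) (z : g),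
    θ (Fin.snoc (fun i => L.β (L.β (x i))) (L.br (twMap ⇑L.α ⇑L.β y))) z
        - θ (twMap ⇑L.α ⇑L.β y) (L.br (Fin.snoc (fun i => L.β (L.β (x i))) z)) =
      ∑ k : Fin (m + 2), ((-1 : K) ^ (m + 1 - (k : ℕ))) •
        (θ (Fin.snoc (fun i : Fin (m + 1) => L.β (L.β (y (k.succAbove i))))
              (L.br (twMap ⇑L.α ⇑L.β (Fin.snoc x (y k))))) z
          - θ (twMap ⇑L.α ⇑L.β (Fin.snoc x (y k)))
              (L.br (Fin.snoc (fun i => L.β (L.β (y (k.succAbove i)))) z))))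

/-- `S` is the `T*_θ`-extension of the `n`-BiHom-Lie algebra `L` (`n = m + 2`) by the
cocycle `θ`, built from the coadjoint representation. -/
def IsTStarExt {K : Type u} [Field K] {m : ℕ} {g : Type v}
    [AddCommGroup g] [Module K g] (L : NBiHomLie K (m + 1) g)
    (θ : (Fin (m + 2) → g) → Module.Dual K g)
    (S : NBiHomLie K (m + 1) (g × Module.Dual K g)) : Prop :=
  (∀ p : g × Module.Dual K g, S.α p = (L.α p.1, p.2 ∘ₗ L.α)) ∧
  (∀ p : g × Module.Dual K g, S.β p = (L.β p.1, p.2 ∘ₗ L.β)) ∧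
  (∀ z : Fin (m + 2) → g × Module.Dual K g, (S.br z).1 = L.br fun i => (z i).1) ∧
  (∀ (z : Fin (m + 2) → g × Module.Dual K g) (w : g),
    (S.br z).2 w = θ (fun i => (z i).1) w
      + (∑ i : Fin (m + 1), ((-1 : K) ^ (m + 1 - (i : ℕ))) •
          (- (z i.castSucc).2 (Function.invFun ⇑L.β (L.α (L.br
              (Fin.snoc (Fin.snoc (fun j : Fin m => (z ((i.succAbove j).castSucc)).1)
                (Function.invFun ⇑L.α (L.β ((z (Fin.last (m + 1))).1)))) w))))))
      + (- (z (Fin.last (m + 1))).2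
            (L.br (Fin.snoc (fun j : Fin (m + 1) => (z j.castSucc).1) w))))
/-- The derived series of an `n`-BiHom-Lie algebra (`n = m + 1`):
`g⁽⁰⁾ = g`, `g⁽ᵖ⁺¹⁾ = [g⁽ᵖ⁾, …, g⁽ᵖ⁾, g]`. -/
def nbhlDerivedSeries {K : Type u} [Field K] {m : ℕ} {g : Type v} [AddCommGroup g] [Module K g]
    (L : NBiHomLie K m g) : ℕ → Submodule K g
  | 0 => ⊤
  | p + 1 => Submodule.span K
      {z | ∃ (a : Fin m → g) (b : g), (∀ i, a i ∈ nbhlDerivedSeries L p) ∧ z = L.br (Fin.snoc a b)}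

/-- The central descending series of an `n`-BiHom-Lie algebra (`n = m + 1`):
`g⁰ = g`, `gᵖ⁺¹ = [gᵖ, g, …, g]`. -/
def nbhlCentralSeries {K : Type u} [Field K] {m : ℕ} {g : Type v} [AddCommGroup g] [Module K g]
    (L : NBiHomLie K m g) : ℕ → Submodule K g
  | 0 => ⊤
  | p + 1 => Submodule.span K
      {z | ∃ (a : g) (b : Fin m → g), a ∈ nbhlCentralSeries L p ∧ z = L.br (Fin.cons a b)}

/-- `(L, B)` is a quadratic `n`-BiHom-Lie algebra (`n = m + 1`): the bilinear form `B` is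
nondegenerate, symmetric, `αβ`-invariant and `α`, `β` are `B`-symmetric. -/
def IsQuadratic {K : Type u} [Field K] {m : ℕ} {E : Type v} [AddCommGroup E] [Module K E]
    (L : NBiHomLie K m E) (B : E → E → K) : Prop :=
  (∀ x, (∀ y, B x y = 0) → x = 0) ∧
  (∀ x y, B x y = B y x) ∧
  (∀ (x : Fin m → E) (u v : E),
    B (L.br (twMap ⇑L.α ⇑L.β (Fin.snoc x u))) (L.α v) =
      - B (L.α u) (L.br (twMap ⇑L.α ⇑L.β (Fin.snoc x v)))) ∧
  (∀ x y, B (L.α x) y = B x (L.α y)) ∧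
  (∀ x y, B (L.β x) y = B x (L.β y))

/-- `f` is a `1`-cochain of the `n`-BiHom-Lie algebra `L`. -/
def IsCochain1 {K : Type u} [Field K] {m : ℕ} {g : Type v} [AddCommGroup g] [Module K g]
    (L : NBiHomLie K m g) (f : g → g) : Prop :=
  (∀ z, f (L.α z) = L.α (f z)) ∧ (∀ z, f (L.β z) = L.β (f z))

/-- `c` is a `2`-cochain of the `n`-BiHom-Lie algebra `L` (`n = m + 1`). -/
def IsCochain2 {K : Type u} [Field K] {m : ℕ} {g : Type v} [AddCommGroup g] [Module K g]
    (L : NBiHomLie K m g) (c : (Fin (m + 1) → g) → g) : Prop :=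
  (∀ x, L.α (c x) = c fun i => L.α (x i)) ∧ (∀ x, L.β (c x) = c fun i => L.β (x i))

/-- `d` is a `3`-cochain of the `n`-BiHom-Lie algebra `L` (`n = m + 1`). -/
def IsCochain3 {K : Type u} [Field K] {m : ℕ} {g : Type v} [AddCommGroup g] [Module K g]
    (L : NBiHomLie K m g) (d : (Fin m → g) → (Fin (m + 1) → g) → g) : Prop :=
  (∀ x y, L.α (d x y) = d (fun i => L.α (x i)) fun i => L.α (y i)) ∧
  (∀ x y, L.β (d x y) = d (fun i => L.β (x i)) fun i => L.β (y i))

/-- The first coboundary operator `δ¹` of an `n`-BiHom-Lie algebra (`n = m + 1`). -/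
def delta1 {K : Type u} [Field K] {m : ℕ} {g : Type v} [AddCommGroup g] [Module K g]
    (L : NBiHomLie K m g) (f : g → g) : (Fin (m + 1) → g) → g :=
  fun x => - f (L.br x) + ∑ i : Fin (m + 1), L.br (Function.update x i (f (x i)))

/-- The second coboundary operator `δ²` of an `n`-BiHom-Lie algebra (`n = m + 1`). -/
def delta2 {K : Type u} [Field K] {m : ℕ} {g : Type v} [AddCommGroup g] [Module K g]
    (L : NBiHomLie K m g) (c : (Fin (m + 1) → g) → g) :
    (Fin m → g) → (Fin (m + 1) → g) → g :=
  fun x y =>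
    L.br (Fin.snoc (fun i => L.β (L.β (x i))) (c (twMap ⇑L.α ⇑L.β y))) +
      c (Fin.snoc (fun i => L.β (L.β (x i))) (L.br (twMap ⇑L.α ⇑L.β y))) -
      ∑ i : Fin (m + 1), ((-1 : K) ^ (m - (i : ℕ))) •
        (L.br (Fin.snoc (fun j : Fin m => L.β (L.β (y (i.succAbove j))))
            (c (twMap ⇑L.α ⇑L.β (Fin.snoc x (y i))))) +
          c (Fin.snoc (fun j : Fin m => L.β (L.β (y (i.succAbove j))))
            (L.br (twMap ⇑L.α ⇑L.β (Fin.snoc x (y i))))))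

/-- `F` is a one-parameter formal deformation `f_t = Σ_p F p · tᵖ` of the
`n`-BiHom-Lie algebra `L` (`n = m + 1`). -/
def IsDeformation {K : Type u} [Field K] {m : ℕ} {g : Type v} [AddCommGroup g] [Module K g]
    (L : NBiHomLie K m g) (F : ℕ → MultilinearMap K (fun _ : Fin (m + 1) => g) g) : Prop :=
  (∀ x, F 0 x = L.br x) ∧
  (∀ (p : ℕ) (x : Fin (m + 1) → g), L.α (F p x) = F p fun i => L.α (x i)) ∧
  (∀ (p : ℕ) (x : Fin (m + 1) → g), L.β (F p x) = F p fun i => L.β (x i)) ∧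
  (∀ (l : ℕ) (x : Fin m → g) (y : Fin (m + 1) → g),
    ∑ p ∈ Finset.range (l + 1),
        F p (Fin.snoc (fun i => L.β (L.β (x i))) (F (l - p) (twMap ⇑L.α ⇑L.β y))) =
      ∑ k : Fin (m + 1), ((-1 : K) ^ (m - (k : ℕ))) •
        ∑ p ∈ Finset.range (l + 1),
          F p (Fin.snoc (fun j => L.β (L.β (y (k.succAbove j))))
            (F (l - p) (twMap ⇑L.α ⇑L.β (Fin.snoc x (y k))))))

/-- `Ψ` is a formal automorphism exhibiting the equivalence of the deformations
`F` and `F'` of the `n`-BiHom-Lie algebra `L` (`n = m + 1`). -/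
def IsEquivDeform {K : Type u} [Field K] {m : ℕ} {g : Type v} [AddCommGroup g] [Module K g]
    (L : NBiHomLie K m g) (F F' : ℕ → MultilinearMap K (fun _ : Fin (m + 1) => g) g)
    (Ψ : ℕ → (g →ₗ[K] g)) : Prop :=
  (∀ z, Ψ 0 z = z) ∧
  (∀ (i : ℕ) (z : g), Ψ i (L.α z) = L.α (Ψ i z)) ∧
  (∀ (i : ℕ) (z : g), Ψ i (L.β z) = L.β (Ψ i z)) ∧
  (∀ (l : ℕ) (x : Fin (m + 1) → g),
    ∑ p ∈ Finset.range (l + 1), Ψ p (F (l - p) x) =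
      ∑ p ∈ Finset.range (l + 1),
        ∑ c ∈ Fintype.piFinset (fun _ : Fin (m + 1) => Finset.range (l + 1)),
          if p + ∑ i, c i = l then F' p (fun i => Ψ (c i) (x i)) else 0)
/-- The data of a `T*_θ`-extension: an `n`-BiHom-Lie algebra `B` (`n = m + 2`), an
`n`-cocycle `θ : Bⁿ → B*` for the coadjoint representation satisfying the symmetry
condition, and the resulting quadratic `n`-BiHom-Lie algebra structure on `B ⊕ B*`. -/
structure TStarExtData (K : Type u) [Field K] (m : ℕ) where
  B : Type v
  [addB : AddCommGroup B]
  [modB : Module K B]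
  LB : NBiHomLie K (m + 1) B
  θ : MultilinearMap K (fun _ : Fin (m + 2) => B) (Module.Dual K B)
  hθ : IsCoadCocycle LB ⇑θ
  hθsym : ∀ (x : Fin (m + 1) → B) (u v : B),
    θ (twMap ⇑LB.α ⇑LB.β (Fin.snoc x u)) (LB.α v) +
      θ (twMap ⇑LB.α ⇑LB.β (Fin.snoc x v)) (LB.α u) = 0
  S : NBiHomLie K (m + 1) (B × Module.Dual K B)
  hS : IsTStarExt LB ⇑θ S

attribute [instance] TStarExtData.addB TStarExtData.modB

namespace NRigid

theorem sum_assoc {M : Type*} [AddCommMonoid M] (l : ℕ) (f : ℕ → ℕ → ℕ → M) :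
    ∑ rs ∈ antidiagonal l, ∑ pq ∈ antidiagonal rs.2, f rs.1 pq.1 pq.2 =
      ∑ aq ∈ antidiagonal l, ∑ rp ∈ antidiagonal aq.1, f rp.1 rp.2 aq.2 := by
  rw [Finset.sum_sigma', Finset.sum_sigma']
  refine Finset.sum_nbij' (fun z => ⟨(z.1.1 + z.2.1, z.2.2), (z.1.1, z.2.1)⟩)
    (fun z => ⟨(z.2.1, z.2.2 + z.1.2), (z.2.2, z.1.2)⟩) ?_ ?_ ?_ ?_ ?_
  · rintro ⟨⟨a, b⟩, ⟨c, d⟩⟩ h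
    simp at h ⊢
    omega
  · rintro ⟨⟨a, b⟩, ⟨c, d⟩⟩ h
    simp at h ⊢
    omega
  · rintro ⟨⟨a, b⟩, ⟨c, d⟩⟩ h
    simp at h ⊢
    omega
  · rintro ⟨⟨a, b⟩, ⟨c, d⟩⟩ h
    simp at h ⊢
    omega
  · rintro ⟨⟨a, b⟩, ⟨c, d⟩⟩ h
    rfl

theorem sum_snoc {M : Type*} [AddCommMonoid M] {m : ℕ} (l : ℕ) (f : (Fin (m + 1) → ℕ) → M) :
    ∑ c ∈ piAntidiag univ l, f c =
      ∑ er ∈ antidiagonal l, ∑ c ∈ piAntidiag (univ : Finset (Fin m)) er.1,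
        f (Fin.snoc (α := fun _ => ℕ) c er.2) := by
  rw [Finset.sum_sigma']
  refine Finset.sum_nbij' (fun c => ⟨(∑ i : Fin m, c i.castSucc, c (Fin.last m)),
    fun i => c i.castSucc⟩) (fun z => Fin.snoc (α := fun _ => ℕ) z.2 z.1.2) ?_ ?_ ?_ ?_ ?_
  · intro c h
    simp [Fin.sum_univ_castSucc] at h ⊢
    exact h
  · rintro ⟨⟨a, b⟩, c⟩ h
    have he : univ.sum c = ∑ x, c x := rfl
    simp [Fin.sum_univ_castSucc] at h ⊢
    omega
  · intro c h
    exact Fin.snoc_init_self c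
  · rintro ⟨⟨a, b⟩, c⟩ h
    simp at h ⊢
    exact h.2
  · intro c h
    congr 1
    exact (Fin.snoc_init_self c).symm

def T (m l : ℕ) : Finset ((Fin m → ℕ) × (Fin (m + 1) → ℕ)) :=
  ((Fintype.piFinset fun _ => range (l + 1)) ×ˢ (Fintype.piFinset fun _ => range (l + 1))).filter
    fun z => ∑ i, z.1 i + ∑ i, z.2 i = l

theorem mem_T {m l : ℕ} (z : (Fin m → ℕ) × (Fin (m + 1) → ℕ)) :
    z ∈ T m l ↔ ∑ i, z.1 i + ∑ i, z.2 i = l := by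
  simp only [T, mem_filter, mem_product, Fintype.mem_piFinset, mem_range, and_iff_right_iff_imp]
  intro h
  constructor
  · intro i
    have := Finset.single_le_sum (f := z.1) (fun _ _ => Nat.zero_le _) (mem_univ i)
    omega
  · intro i
    have := Finset.single_le_sum (f := z.2) (fun _ _ => Nat.zero_le _) (mem_univ i)
    omega

theorem sum_T {M : Type*} [AddCommMonoid M] {m : ℕ} (l : ℕ)
    (f : (Fin m → ℕ) → (Fin (m + 1) → ℕ) → M) :
    ∑ eb ∈ antidiagonal l, ∑ c ∈ piAntidiag univ eb.1, ∑ d ∈ piAntidiag univ eb.2, f c d =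
      ∑ z ∈ T m l, f z.1 z.2 := by
  rw [← Finset.sum_fiberwise_of_maps_to (s := T m l) (t := antidiagonal l)
    (g := fun z => (∑ i, z.1 i, ∑ i, z.2 i))]
  · refine Finset.sum_congr rfl fun eb heb => ?_
    rw [← Finset.sum_product']
    refine Finset.sum_congr ?_ fun _ _ => rfl
    ext z
    simp only [mem_product, mem_filter, mem_T, mem_piAntidiag, HasAntidiagonal.mem_antidiagonal] at heb ⊢
    rw [Prod.ext_iff]
    have he1 : univ.sum z.1 = ∑ i, z.1 i := rfl
    have he2 : univ.sum z.2 = ∑ i, z.2 i := rfl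
    simp
    omega
  · intro z hz
    simpa [mem_T] using hz

theorem sum_T_swap {M : Type*} [AddCommMonoid M] {m : ℕ} (l : ℕ) (k : Fin (m + 1))
    (f : (Fin m → ℕ) → (Fin (m + 1) → ℕ) → M) :
    ∑ z ∈ T m l, f z.1 z.2 =
      ∑ z ∈ T m l, f (fun j => z.2 (k.succAbove j)) (Fin.snoc (α := fun _ => ℕ) z.1 (z.2 k)) := by
  symm
  refine Finset.sum_nbij' (fun z => (fun j => z.2 (k.succAbove j),
      Fin.snoc (α := fun _ => ℕ) z.1 (z.2 k)))
    (fun z => (fun j => z.2 j.castSucc,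
      k.insertNth (α := fun _ => ℕ) (z.2 (Fin.last m)) z.1)) ?_ ?_ ?_ ?_ ?_
  · intro z hz
    rw [mem_T] at hz ⊢
    rw [Fin.sum_univ_succAbove _ k] at hz
    simp [Fin.sum_univ_castSucc]
    omega
  · intro z hz
    rw [mem_T] at hz ⊢
    rw [Fin.sum_univ_castSucc] at hz
    rw [Fin.sum_univ_succAbove _ k]
    simp
    omega
  · rintro ⟨a, b⟩ hz
    simp
    exact Fin.insertNth_self_removeNth k b
  · rintro ⟨a, b⟩ hz
    simp
    exact Fin.snoc_init_self b
  · intro z hz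
    rfl

variable {K : Type u} [Field K] {m : ℕ} {g : Type v} [AddCommGroup g] [Module K g]

def D (Ψ : ℕ → (g →ₗ[K] g)) (F : ℕ → MultilinearMap K (fun _ : Fin (m + 1) => g) g)
    (q : ℕ) (x : Fin (m + 1) → g) : g :=
  ∑ ij ∈ antidiagonal q, Ψ ij.1 (F ij.2 x)

def B (L : NBiHomLie K m g) (Ψ : ℕ → (g →ₗ[K] g)) (q : ℕ) (x : Fin (m + 1) → g) : g :=
  ∑ c ∈ piAntidiag univ q, L.br (fun i => Ψ (c i) (x i))

theorem tw_comm (L : NBiHomLie K m g) (Ψ : ℕ → (g →ₗ[K] g))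
    (ha : ∀ i z, Ψ i (L.α z) = L.α (Ψ i z)) (hb : ∀ i z, Ψ i (L.β z) = L.β (Ψ i z))
    (d : Fin (m + 1) → ℕ) (y : Fin (m + 1) → g) :
    (fun i => Ψ (d i) (twMap ⇑L.α ⇑L.β y i)) = twMap ⇑L.α ⇑L.β (fun i => Ψ (d i) (y i)) := by
  funext i
  simp only [twMap]
  split_ifs
  · exact ha _ _
  · exact hb _ _

theorem snoc_comm {m : ℕ} (Ψ : ℕ → g → g) (c : Fin m → ℕ) (r : ℕ) (x : Fin m → g) (v : g) :
    (fun i => Ψ ((Fin.snoc (α := fun _ => ℕ) c r : Fin (m + 1) → ℕ) i)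
      ((Fin.snoc (α := fun _ => g) x v : Fin (m + 1) → g) i)) =
      Fin.snoc (α := fun _ => g) (fun i => Ψ (c i) (x i)) (Ψ r v) := by
  funext i
  refine Fin.lastCases ?_ (fun j => ?_) i <;> simp

theorem br_snoc_sum (L : NBiHomLie K m g) {ι : Type*} (s : Finset ι) (u : Fin m → g) (f : ι → g) :
    L.br (Fin.snoc (α := fun _ => g) u (∑ i ∈ s, f i)) =
      ∑ i ∈ s, L.br (Fin.snoc (α := fun _ => g) u (f i)) := by
  have h : ∀ v : g, L.br (Fin.snoc (α := fun _ => g) u v) =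
      L.br.toLinearMap (Fin.snoc (α := fun _ => g) u 0) (Fin.last m) v := by
    intro v
    simp [MultilinearMap.toLinearMap, Fin.update_snoc_last]
  simp only [h, map_sum]

theorem br_snoc_add (L : NBiHomLie K m g) (u : Fin m → g) (v w : g) :
    L.br (Fin.snoc (α := fun _ => g) u (v + w)) =
      L.br (Fin.snoc (α := fun _ => g) u v) + L.br (Fin.snoc (α := fun _ => g) u w) := by
  have h : ∀ v : g, L.br (Fin.snoc (α := fun _ => g) u v) =
      L.br.toLinearMap (Fin.snoc (α := fun _ => g) u 0) (Fin.last m) v := by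
    intro v
    simp [MultilinearMap.toLinearMap, Fin.update_snoc_last]
  simp only [h, map_add]

def G (L : NBiHomLie K m g) (x : Fin m → g) (y : Fin (m + 1) → g) : g :=
  L.br (Fin.snoc (fun i => L.β (L.β (x i))) (L.br (twMap ⇑L.α ⇑L.β y)))

def J (L : NBiHomLie K m g) (Ψ : ℕ → (g →ₗ[K] g)) (l : ℕ)
    (x : Fin m → g) (y : Fin (m + 1) → g) : g :=
  ∑ z ∈ T m l, G L (fun i => Ψ (z.1 i) (x i)) (fun i => Ψ (z.2 i) (y i))

theorem J_jacobi (L : NBiHomLie K m g) (Ψ : ℕ → (g →ₗ[K] g)) (l : ℕ)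
    (x : Fin m → g) (y : Fin (m + 1) → g) :
    J L Ψ l x y = ∑ k : Fin (m + 1), ((-1 : K) ^ (m - (k : ℕ))) •
      J L Ψ l (fun j => y (k.succAbove j)) (Fin.snoc (α := fun _ => g) x (y k)) := by
  have h : ∀ k : Fin (m + 1),
      J L Ψ l (fun j => y (k.succAbove j)) (Fin.snoc (α := fun _ => g) x (y k)) =
      ∑ z ∈ T m l, G L (fun j => Ψ (z.2 (k.succAbove j)) (y (k.succAbove j)))
        (Fin.snoc (α := fun _ => g) (fun i => Ψ (z.1 i) (x i)) (Ψ (z.2 k) (y k))) := by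
    intro k
    unfold J
    rw [sum_T_swap l k (fun a b => G L (fun i => Ψ (a i) (y (k.succAbove i)))
      (fun i => Ψ (b i) ((Fin.snoc (α := fun _ => g) x (y k) : Fin (m + 1) → g) i)))]
    refine Finset.sum_congr rfl fun z _ => ?_
    rw [snoc_comm (fun i => ⇑(Ψ i))]
  simp only [h, Finset.smul_sum]
  rw [Finset.sum_comm]
  refine Finset.sum_congr rfl fun z _ => ?_
  exact L.jacobi _ _

theorem key (L : NBiHomLie K m g) (F : ℕ → MultilinearMap K (fun _ : Fin (m + 1) => g) g)
    (Ψ : ℕ → (g →ₗ[K] g)) (l : ℕ) (c : (Fin (m + 1) → g) → g)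
    (h0 : ∀ z, Ψ 0 z = z) (hF0 : ∀ x, F 0 x = L.br x)
    (ha : ∀ i z, Ψ i (L.α z) = L.α (Ψ i z)) (hb : ∀ i z, Ψ i (L.β z) = L.β (Ψ i z))
    (hD : ∀ q ≤ l, ∀ x, D Ψ F q x = B L Ψ q x + if q = l then c x else 0)
    (x : Fin m → g) (y : Fin (m + 1) → g) :
    ∑ rs ∈ antidiagonal l, ∑ pq ∈ antidiagonal rs.2, Ψ rs.1 (F pq.1
      (Fin.snoc (fun i => L.β (L.β (x i))) (F pq.2 (twMap ⇑L.α ⇑L.β y)))) =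
    J L Ψ l x y + L.br (Fin.snoc (fun i => L.β (L.β (x i))) (c (twMap ⇑L.α ⇑L.β y))) +
      c (Fin.snoc (fun i => L.β (L.β (x i))) (L.br (twMap ⇑L.α ⇑L.β y))) := by
  rw [sum_assoc l (fun r p q => Ψ r (F p
    (Fin.snoc (α := fun _ => g) (fun i => L.β (L.β (x i))) (F q (twMap ⇑L.α ⇑L.β y)))))]
  have e1 : ∀ aq ∈ antidiagonal l, ∑ rp ∈ antidiagonal aq.1, Ψ rp.1 (F rp.2
      (Fin.snoc (α := fun _ => g) (fun i => L.β (L.β (x i))) (F aq.2 (twMap ⇑L.α ⇑L.β y)))) =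
      (∑ er ∈ antidiagonal aq.1, ∑ d ∈ piAntidiag univ er.1,
        L.br (Fin.snoc (α := fun _ => g) (fun i => L.β (L.β (Ψ (d i) (x i))))
          (Ψ er.2 (F aq.2 (twMap ⇑L.α ⇑L.β y))))) +
      if aq = (l, 0) then
        c (Fin.snoc (fun i => L.β (L.β (x i))) (L.br (twMap ⇑L.α ⇑L.β y))) else 0 := by
    rintro ⟨a, q⟩ haq
    rw [HasAntidiagonal.mem_antidiagonal] at haq
    simp only at haq
    have := hD a (by omega)
      (Fin.snoc (α := fun _ => g) (fun i => L.β (L.β (x i))) (F q (twMap ⇑L.α ⇑L.β y)))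
    unfold D at this
    simp only
    rw [this]
    congr 1
    · unfold B
      rw [sum_snoc]
      refine Finset.sum_congr rfl fun er _ => Finset.sum_congr rfl fun d _ => ?_
      rw [snoc_comm (fun i => ⇑(Ψ i))]
      simp only [hb]
    · by_cases hal : a = l
      · have : q = 0 := by omega
        subst this
        simp [hal, hF0]
      · simp [hal]
  rw [Finset.sum_congr rfl e1, Finset.sum_add_distrib, Finset.sum_ite_eq',
    if_pos (by simp)]
  congr 1
  rw [← sum_assoc l (fun e r q => ∑ d ∈ piAntidiag univ e,
        L.br (Fin.snoc (α := fun _ => g) (fun i => L.β (L.β (Ψ (d i) (x i))))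
          (Ψ r (F q (twMap ⇑L.α ⇑L.β y)))))]
  have e2 : ∀ eb ∈ antidiagonal l, ∑ rq ∈ antidiagonal eb.2, ∑ d ∈ piAntidiag univ eb.1,
        L.br (Fin.snoc (α := fun _ => g) (fun i => L.β (L.β (Ψ (d i) (x i))))
          (Ψ rq.1 (F rq.2 (twMap ⇑L.α ⇑L.β y)))) =
      (∑ d ∈ piAntidiag univ eb.1, ∑ d' ∈ piAntidiag univ eb.2,
        G L (fun i => Ψ (d i) (x i)) (fun i => Ψ (d' i) (y i))) +
      if eb = (0, l) then
        L.br (Fin.snoc (fun i => L.β (L.β (x i))) (c (twMap ⇑L.α ⇑L.β y))) else 0 := by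
    rintro ⟨e, b⟩ heb
    rw [HasAntidiagonal.mem_antidiagonal] at heb
    simp only at heb ⊢
    have := hD b (by omega) (twMap ⇑L.α ⇑L.β y)
    unfold D at this
    rw [Finset.sum_comm]
    simp only [← br_snoc_sum]
    rw [this]
    simp only [br_snoc_add]
    rw [Finset.sum_add_distrib]
    congr 1
    · refine Finset.sum_congr rfl fun d _ => ?_
      unfold B
      rw [br_snoc_sum]
      refine Finset.sum_congr rfl fun d' _ => ?_
      rw [tw_comm L Ψ ha hb]
      rfl
    · by_cases hal : b = l
      · have : e = 0 := by omega
        subst this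
        simp [hal, h0]
      · have hz : ∀ u : Fin m → g, L.br (Fin.snoc (α := fun _ => g) u (0 : g)) = 0 := fun u =>
          L.br.map_coord_zero (Fin.last m) (by simp)
        simp [hal, hz]
  rw [Finset.sum_congr rfl e2, Finset.sum_add_distrib, Finset.sum_ite_eq',
    if_pos (by simp)]
  congr 1
  rw [sum_T l (fun a b => G L (fun i => Ψ (a i) (x i)) (fun i => Ψ (b i) (y i)))]
  rfl

theorem cocycle (L : NBiHomLie K m g) (F : ℕ → MultilinearMap K (fun _ : Fin (m + 1) => g) g)
    (hF : IsDeformation L F)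
    (Ψ : ℕ → (g →ₗ[K] g)) (l : ℕ) (c : (Fin (m + 1) → g) → g)
    (h0 : ∀ z, Ψ 0 z = z)
    (ha : ∀ i z, Ψ i (L.α z) = L.α (Ψ i z)) (hb : ∀ i z, Ψ i (L.β z) = L.β (Ψ i z))
    (hD : ∀ q ≤ l, ∀ x, D Ψ F q x = B L Ψ q x + if q = l then c x else 0)
    (x : Fin m → g) (y : Fin (m + 1) → g) : delta2 L c x y = 0 := by
  have hk := key L F Ψ l c h0 hF.1 ha hb hD
  have hj : ∑ rs ∈ antidiagonal l, ∑ pq ∈ antidiagonal rs.2, Ψ rs.1 (F pq.1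
      (Fin.snoc (fun i => L.β (L.β (x i))) (F pq.2 (twMap ⇑L.α ⇑L.β y)))) =
      ∑ k : Fin (m + 1), ((-1 : K) ^ (m - (k : ℕ))) •
      ∑ rs ∈ antidiagonal l, ∑ pq ∈ antidiagonal rs.2, Ψ rs.1 (F pq.1
      (Fin.snoc (fun i => L.β (L.β (y (k.succAbove i))))
        (F pq.2 (twMap ⇑L.α ⇑L.β (Fin.snoc (α := fun _ => g) x (y k)))))) := by
    simp only [Finset.smul_sum]
    rw [Finset.sum_comm]
    refine Finset.sum_congr rfl fun rs _ => ?_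
    have h := hF.2.2.2 rs.2 x y
    have hs : ∀ (u : Fin m → g) (w : Fin (m + 1) → g),
        ∑ p ∈ Finset.range (rs.2 + 1), F p (Fin.snoc (α := fun _ => g) u (F (rs.2 - p) w)) =
        ∑ pq ∈ antidiagonal rs.2, F pq.1 (Fin.snoc (α := fun _ => g) u (F pq.2 w)) :=
      fun u w => (Finset.Nat.sum_antidiagonal_eq_sum_range_succ
        (fun p q => F p (Fin.snoc (α := fun _ => g) u (F q w))) rs.2).symm
    simp only [hs] at h
    have h' := congrArg (Ψ rs.1) h
    simp only [map_sum, map_smul, Finset.smul_sum] at h'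
    exact h'
  rw [hk] at hj
  simp only [hk] at hj
  rw [J_jacobi] at hj
  simp only [add_assoc] at hj
  simp only [smul_add, Finset.sum_add_distrib] at hj
  have := add_left_cancel hj
  unfold delta2
  rw [this]
  simp only [smul_add, Finset.sum_add_distrib, sub_self]

def Comm (L : NBiHomLie K m g) (h : g →ₗ[K] g) : Prop :=
  (∀ z, h (L.α z) = L.α (h z)) ∧ (∀ z, h (L.β z) = L.β (h z))

/-- good up to order `< l` -/
def Good (L : NBiHomLie K m g) (F : ℕ → MultilinearMap K (fun _ : Fin (m + 1) => g) g)
    (l : ℕ) (Ψ : ℕ → (g →ₗ[K] g)) : Prop :=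
  Ψ 0 = LinearMap.id ∧ (∀ i, Comm L (Ψ i)) ∧ (∀ i, l ≤ i → Ψ i = 0) ∧
    ∀ q < l, ∀ x, D Ψ F q x = B L Ψ q x

theorem D_congr (F : ℕ → MultilinearMap K (fun _ : Fin (m + 1) => g) g)
    (Ψ Φ : ℕ → (g →ₗ[K] g)) (q : ℕ) (h : ∀ i ≤ q, Ψ i = Φ i) (x : Fin (m + 1) → g) :
    D Ψ F q x = D Φ F q x := by
  refine Finset.sum_congr rfl fun ij hij => ?_
  rw [HasAntidiagonal.mem_antidiagonal] at hij
  rw [h _ (by omega)]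

theorem le_of_mem {q : ℕ} {c : Fin (m + 1) → ℕ} (hc : c ∈ piAntidiag univ q) (i : Fin (m + 1)) :
    c i ≤ q := by
  rw [mem_piAntidiag] at hc
  rw [← hc.1]
  exact Finset.single_le_sum (f := c) (fun _ _ => Nat.zero_le _) (mem_univ i)

theorem B_congr (L : NBiHomLie K m g)
    (Ψ Φ : ℕ → (g →ₗ[K] g)) (q : ℕ) (h : ∀ i ≤ q, Ψ i = Φ i) (x : Fin (m + 1) → g) :
    B L Ψ q x = B L Φ q x := by
  refine Finset.sum_congr rfl fun c hc => ?_
  congr 1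
  funext i
  rw [h _ (le_of_mem hc i)]

theorem B_update (L : NBiHomLie K m g) (Ψ : ℕ → (g →ₗ[K] g)) (l : ℕ) (hl : 0 < l)
    (h0 : Ψ 0 = LinearMap.id) (hz : Ψ l = 0) (h : g →ₗ[K] g) (x : Fin (m + 1) → g) :
    B L (Function.update Ψ l h) l x = B L Ψ l x +
      ∑ i : Fin (m + 1), L.br (Function.update x i (h (x i))) := by
  rw [← sub_eq_iff_eq_add']
  unfold B
  rw [← Finset.sum_sub_distrib]
  have hinj : Function.Injective (fun i : Fin (m + 1) => (Pi.single i l : Fin (m + 1) → ℕ)) := by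
    intro i j hij
    by_contra hne
    have := congrFun hij i
    simp [Pi.single_eq_of_ne hne] at this
    omega
  rw [← Finset.sum_subset (s₁ := univ.image fun i : Fin (m + 1) =>
    (Pi.single i l : Fin (m + 1) → ℕ))]
  · rw [Finset.sum_image fun a _ b _ hab => hinj hab]
    refine Finset.sum_congr rfl fun i _ => ?_
    have hzero : L.br (fun j => Ψ ((Pi.single i l : Fin (m + 1) → ℕ) j) (x j)) = 0 :=
      L.br.map_coord_zero i (by simp [hz])
    rw [hzero, sub_zero]
    congr 1
    funext j
    by_cases hj : j = i
    · subst hj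
      simp
    · simp [hj, Function.update_of_ne (show (0 : ℕ) ≠ l by omega), h0]
  · intro c hc
    simp only [mem_image, mem_univ, true_and] at hc
    obtain ⟨i, rfl⟩ := hc
    simp
  · intro c hc hni
    rw [sub_eq_zero]
    congr 1
    funext i
    rw [Function.update_of_ne]
    intro hci
    apply hni
    simp only [mem_image, mem_univ, true_and]
    refine ⟨i, ?_⟩
    rw [mem_piAntidiag] at hc
    funext j
    by_cases hj : j = i
    · subst hj
      simp [hci]
    · rw [Pi.single_eq_of_ne hj]
      have he : univ.sum c = ∑ x, c x := rfl
      have := Finset.sum_le_sum_of_subset (f := c) (subset_univ {i, j})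
      rw [Finset.sum_pair (Ne.symm hj)] at this
      omega

theorem D_update (L : NBiHomLie K m g) (F : ℕ → MultilinearMap K (fun _ : Fin (m + 1) => g) g)
    (hF0 : ∀ x, F 0 x = L.br x)
    (Ψ : ℕ → (g →ₗ[K] g)) (l : ℕ)
    (hz : Ψ l = 0) (h : g →ₗ[K] g) (x : Fin (m + 1) → g) :
    D (Function.update Ψ l h) F l x = D Ψ F l x + h (L.br x) := by
  rw [← sub_eq_iff_eq_add']
  unfold D
  rw [← Finset.sum_sub_distrib, Finset.sum_eq_single (l, 0)]
  · simp [hz, hF0]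
  · rintro ⟨a, b⟩ hab hne
    have : a ≠ l := by
      rintro rfl
      simp at hab
      simp [hab] at hne
    simp [Function.update_of_ne this]
  · simp

theorem step (L : NBiHomLie K m g)
    (hH2 : ∀ c : MultilinearMap K (fun _ : Fin (m + 1) => g) g, IsCochain2 L ⇑c →
      (∀ (x : Fin m → g) (y : Fin (m + 1) → g), delta2 L ⇑c x y = 0) →
      ∃ h : g →ₗ[K] g, IsCochain1 L ⇑h ∧ ∀ x : Fin (m + 1) → g, c x = delta1 L ⇑h x)
    (F : ℕ → MultilinearMap K (fun _ : Fin (m + 1) => g) g) (hF : IsDeformation L F)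
    (l : ℕ) (hl : 0 < l) (Ψ : ℕ → (g →ₗ[K] g)) (hΨ : Good L F l Ψ) :
    ∃ h : g →ₗ[K] g, Good L F (l + 1) (Function.update Ψ l h) := by
  obtain ⟨h0, hc, hz, hq⟩ := hΨ
  let c : MultilinearMap K (fun _ : Fin (m + 1) => g) g :=
    ∑ ij ∈ antidiagonal l, (Ψ ij.1).compMultilinearMap (F ij.2) -
      ∑ c ∈ piAntidiag univ l, L.br.compLinearMap (fun i => Ψ (c i))
  have hcx : ∀ x, c x = D Ψ F l x - B L Ψ l x := by
    intro x
    simp [c, D, B]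
  have hA : IsCochain2 L ⇑c := by
    constructor
    · intro x
      rw [hcx, hcx]
      simp only [D, B, map_sub, map_sum, L.alpha_br, ← (hc _).1, hF.2.1]
    · intro x
      rw [hcx, hcx]
      simp only [D, B, map_sub, map_sum, L.beta_br, ← (hc _).2, hF.2.2.1]
  have hB : ∀ (x : Fin m → g) (y : Fin (m + 1) → g), delta2 L ⇑c x y = 0 := by
    refine cocycle L F hF Ψ l c (by simp [h0]) (fun i => (hc i).1) (fun i => (hc i).2) ?_
    intro q hql x
    by_cases h : q = l
    · subst h
      simp [hcx]
    · simp [h, hq q (by omega) x]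
  obtain ⟨h, hh, hhc⟩ := hH2 c hA hB
  · refine ⟨h, ?_, ?_, ?_, ?_⟩
    · rw [Function.update_of_ne (by omega), h0]
    · intro i
      by_cases hi : i = l
      · subst hi
        rw [Function.update_self]
        exact hh
      · rw [Function.update_of_ne hi]
        exact hc i
    · intro i hi
      rw [Function.update_of_ne (by omega)]
      exact hz i (by omega)
    · intro q hql x
      by_cases hql' : q = l
      · subst hql'
        rw [D_update L F hF.1 Ψ q (hz q le_rfl), B_update L Ψ q hl h0 (hz q le_rfl)]
        have h1 := hhc x
        rw [hcx, delta1, sub_eq_iff_eq_add] at h1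
        rw [h1]
        abel
      · have hne : ∀ i ≤ q, Function.update Ψ l h i = Ψ i := fun i hi =>
          Function.update_of_ne (by omega) _ _
        rw [D_congr F _ Ψ q hne, B_congr L _ Ψ q hne]
        exact hq q (by omega) x

open Classical in
noncomputable def seq (L : NBiHomLie K m g)
    (F : ℕ → MultilinearMap K (fun _ : Fin (m + 1) => g) g) : ℕ → ℕ → (g →ₗ[K] g)
  | 0 => fun i => if i = 0 then LinearMap.id else 0
  | k + 1 => if h : ∃ h : g →ₗ[K] g, Good L F (k + 2) (Function.update (seq L F k) (k + 1) h) then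
      Function.update (seq L F k) (k + 1) h.choose else seq L F k

theorem seq_agree (L : NBiHomLie K m g)
    (F : ℕ → MultilinearMap K (fun _ : Fin (m + 1) => g) g) (i k : ℕ) (hik : i ≤ k) :
    seq L F k i = seq L F i i := by
  induction k, hik using Nat.le_induction with
  | base => rfl
  | succ k hk ih =>
    rw [← ih, seq]
    split_ifs
    · rw [Function.update_of_ne (by omega)]
    · rfl

end NRigid

/-- **Rigidity.** If `(g,[·,…,·],α,β)` is an `n`-BiHom-Lie algebra (`n = m + 1`) with
`H²(g,g) = 0` (every `2`-cocycle is a coboundary `δ¹` of a `1`-cochain), then `g` is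
analytically rigid: every one-parameter formal deformation of `g` is equivalent to the
null deformation `f₀ = [·,…,·]`. -/
theorem rigid_of_H2_eq_zero {K : Type u} [Field K] {m : ℕ} {g : Type v}
    [AddCommGroup g] [Module K g] (L : NBiHomLie K m g)
    (hH2 : ∀ c : MultilinearMap K (fun _ : Fin (m + 1) => g) g, IsCochain2 L ⇑c →
      (∀ (x : Fin m → g) (y : Fin (m + 1) → g), delta2 L ⇑c x y = 0) →
      ∃ h : g →ₗ[K] g, IsCochain1 L ⇑h ∧ ∀ x : Fin (m + 1) → g, c x = delta1 L ⇑h x) :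
    ∀ F : ℕ → MultilinearMap K (fun _ : Fin (m + 1) => g) g, IsDeformation L F →
      ∃ Ψ : ℕ → (g →ₗ[K] g),
        IsEquivDeform L F (fun p => if p = 0 then L.br else 0) Ψ := by
  intro F hF
  have hgood : ∀ k, NRigid.Good L F (k + 1) (NRigid.seq L F k) := by
    intro k
    induction k with
    | zero =>
      refine ⟨by simp [NRigid.seq], ?_, ?_, ?_⟩
      · intro i
        by_cases hi : i = 0 <;> simp [NRigid.seq, hi, NRigid.Comm]
      · intro i hi
        simp [NRigid.seq, show i ≠ 0 by omega]
      · intro q hq x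
        obtain rfl : q = 0 := by omega
        simp [NRigid.D, NRigid.B, NRigid.seq, hF.1]
    | succ k ih =>
      have h := NRigid.step L hH2 F hF (k + 1) (by omega) _ ih
      rw [NRigid.seq, dif_pos h]
      exact h.choose_spec
  refine ⟨fun i => NRigid.seq L F i i, ?_, ?_, ?_, ?_⟩
  · intro z
    simp [(hgood 0).1]
  · intro i z
    exact ((hgood i).2.1 i).1 z
  · intro i z
    exact ((hgood i).2.1 i).2 z
  · intro l x
    have h := (hgood l).2.2.2 l (by omega) x
    rw [NRigid.D_congr F _ _ l (fun i hi => NRigid.seq_agree L F i l hi),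
      NRigid.B_congr L _ _ l (fun i hi => NRigid.seq_agree L F i l hi), NRigid.D, NRigid.B,
      Finset.Nat.sum_antidiagonal_eq_sum_range_succ
        (fun p q => NRigid.seq L F p p (F q x))] at h
    refine h.trans ?_
    symm
    rw [Finset.sum_eq_single 0]
    · rw [← Finset.sum_filter]
      refine Finset.sum_congr ?_ fun c _ => by simp
      ext c
      simp only [mem_filter, Fintype.mem_piFinset, mem_range, zero_add]
      symm
      constructor
      · intro hc
        refine ⟨fun i => ?_, (mem_piAntidiag.1 hc).1⟩
        have := NRigid.le_of_mem hc i
        omega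
      · rintro ⟨_, hc⟩
        simpa using hc
    · intro p _ hp
      simp [hp]
    · simp
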